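/- Let X ∈ L²(P) and n ≥ 1. Then Γ(1/n) X^{⋄n} ∈ L²(P) and ‖Γ(1/n) X^{⋄n}‖_{L²(P)} ≤ ‖X‖_{L²(P)}^n. -/

import Mathlib

open MeasureTheory ProbabilityTheory Filter Topology
open scoped ENNReal NNReal

noncomputable section

namespace WickPaper

/-- Lebesgue measure on the cube `[0,T]^n`. -/
def boxMeasure (T : ℝ) (n : ℕ) : Measure (Fin n → ℝ) :=
  Measure.pi fun _ => (volume : Measure ℝ).restrict (Set.Icc 0 T)

instance (T : ℝ) (n : ℕ) : IsFiniteMeasure (boxMeasure T n) := by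
  unfold boxMeasure; infer_instance

/-- `L²([0,T]^n)`. -/
abbrev Ker (T : ℝ) (n : ℕ) := Lp ℝ 2 (boxMeasure T n)

/-- A formal Wiener–Itô chaos series: the sequence of its kernels. -/
abbrev Chaos (T : ℝ) := (n : ℕ) → Ker T n

/-- A kernel is symmetric if it is invariant (a.e.) under permutations of its variables. -/
def IsSymmKer {T : ℝ} {n : ℕ} (h : Ker T n) : Prop :=
  ∀ σ : Equiv.Perm (Fin n),
    (fun x : Fin n → ℝ => (h : (Fin n → ℝ) → ℝ) (x ∘ σ)) =ᵐ[boxMeasure T n]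
      (h : (Fin n → ℝ) → ℝ)

/-- The (possibly infinite) squared `L²(P)`-norm `Σ_n n! |c_n|²` of a chaos series. -/
def chaosNorm2 {T : ℝ} (c : Chaos T) : ℝ≥0∞ :=
  ∑' n : ℕ, (Nat.factorial n : ℝ≥0∞) * (‖c n‖₊ : ℝ≥0∞) ^ 2

/-- A chaos series represents a square-integrable random variable iff `Σ_n n! |c_n|² < ∞`. -/
def ChaosL2 {T : ℝ} (c : Chaos T) : Prop := chaosNorm2 c < ⊤

/-- The second quantization operator `Γ(λ)` on chaos series:  `(Γ(λ)c)_n = λ^n c_n`. -/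
def Gam {T : ℝ} (lam : ℝ) (c : Chaos T) : Chaos T := fun n => lam ^ n • c n

/-- Transport of kernels along an equality of orders. -/
def kerCast {T : ℝ} {j n : ℕ} (h : j = n) (f : Ker T j) : Ker T n := h ▸ f

/-- The sample space of the classical Wiener space over `[0,T]`: continuous paths. -/
abbrev PathSpace (T : ℝ) := C(Set.Icc (0 : ℝ) T, ℝ)

instance (T : ℝ) : MeasurableSpace (PathSpace T) := borel _

instance (T : ℝ) : BorelSpace (PathSpace T) := ⟨rfl⟩

/-- The classical Wiener space over `[0,T]`, together with its Wiener–Itô chaos machinery: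
`P` is the Wiener measure (the coordinate process is a Brownian motion), `I n` is the `n`-th
order multiple Itô integral, `kernels X` is the (unique, symmetric) sequence of kernels in the
Wiener–Itô chaos decomposition of `X`, and `stp` is the symmetrized tensor product of kernels. -/
structure WienerSpace (T : ℝ) where
  T_pos : 0 < T
  /-- the Wiener measure -/
  P : Measure (PathSpace T)
  probP : IsProbabilityMeasure P
  /-- the coordinate process starts at `0` -/
  coord_start : ∀ᵐ ω ∂P, ω ⟨0, Set.left_mem_Icc.mpr T_pos.le⟩ = 0
  /-- increments of the coordinate process are centered Gaussian -/
  coord_gauss : ∀ s t : Set.Icc (0 : ℝ) T, (s : ℝ) ≤ t →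
    Measure.map (fun ω : PathSpace T => ω t - ω s) P = gaussianReal 0 ((t : ℝ) - s).toNNReal
  /-- increments of the coordinate process over disjoint intervals are independent -/
  coord_indep : ∀ (n : ℕ) (t : Fin (n + 1) → Set.Icc (0 : ℝ) T),
    Monotone (fun i => (t i : ℝ)) →
    iIndepFun (m := fun _ => Real.measurableSpace)
      (fun (i : Fin n) (ω : PathSpace T) => ω (t i.succ) - ω (t i.castSucc)) P
  /-- the `n`-th order multiple Itô integral -/
  I : (n : ℕ) → Ker T n → Lp ℝ 2 P
  I_linear : ∀ n : ℕ, IsLinearMap ℝ (I n)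
  /-- `I 0` of a kernel is the corresponding constant -/
  I_zero : ∀ h : Ker T 0,
    (I 0 h : PathSpace T → ℝ) =ᵐ[P] fun _ => ∫ x, h x ∂boxMeasure T 0
  /-- `I 1` is the Wiener integral: it is a centered Gaussian with variance `|h|²` -/
  I_one_gauss : ∀ h : Ker T 1,
    Measure.map (I 1 h : PathSpace T → ℝ) P = gaussianReal 0 (‖h‖₊ ^ 2)
  /-- multiple Itô integrals of order `≥ 1` are centered -/
  I_mean_zero : ∀ n : ℕ, 1 ≤ n → ∀ h : Ker T n, ∫ ω, (I n h) ω ∂P = 0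
  /-- the Itô isometry on symmetric kernels: `‖I_n(h)‖ = √(n!) |h|` -/
  I_norm : ∀ (n : ℕ) (h : Ker T n), IsSymmKer h →
    ‖I n h‖ = Real.sqrt (Nat.factorial n) * ‖h‖
  /-- homogeneous chaoses of different orders are orthogonal -/
  I_orth : ∀ {m n : ℕ}, m ≠ n → ∀ (h : Ker T m) (g : Ker T n),
    inner ℝ (I m h) (I n g) = (0 : ℝ)
  /-- the kernels of the Wiener–Itô chaos decomposition of a square integrable `X` -/
  kernels : Lp ℝ 2 P → Chaos T
  kernels_symm : ∀ (X : Lp ℝ 2 P) (n : ℕ), IsSymmKer (kernels X n)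
  /-- the chaos decomposition: `X = Σ_n I_n(h_n)` -/
  kernels_hasSum : ∀ X : Lp ℝ 2 P, HasSum (fun n => I n (kernels X n)) X
  /-- uniqueness of the chaos decomposition -/
  kernels_unique : ∀ (X : Lp ℝ 2 P) (c : Chaos T), (∀ n, IsSymmKer (c n)) →
    HasSum (fun n => I n (c n)) X → c = kernels X
  /-- `‖X‖² = Σ_n n! |h_n|²` -/
  norm_eq : ∀ X : Lp ℝ 2 P, (‖X‖₊ : ℝ≥0∞) ^ 2 = chaosNorm2 (kernels X)
  /-- the symmetrized tensor product `⊗̂` of kernels -/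
  stp : ∀ {j m : ℕ}, Ker T j → Ker T m → Ker T (j + m)
  stp_spec : ∀ {j m : ℕ} (h : Ker T j) (g : Ker T m),
    (stp h g : (Fin (j + m) → ℝ) → ℝ) =ᵐ[boxMeasure T (j + m)]
      fun x => ((Nat.factorial (j + m) : ℝ))⁻¹ *
        ∑ σ : Equiv.Perm (Fin (j + m)),
          h (fun i => x (σ (Fin.castAdd m i))) * g (fun i => x (σ (Fin.natAdd j i)))
  /-- the `n`-fold tensor power `h^{⊗n}` of a one-variable kernel -/
  tpow : Ker T 1 → (n : ℕ) → Ker T n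
  tpow_spec : ∀ (h : Ker T 1) (n : ℕ),
    (tpow h n : (Fin n → ℝ) → ℝ) =ᵐ[boxMeasure T n] fun x => ∏ i, h (fun _ => x i)

namespace WienerSpace

variable {T : ℝ}

/-- `Z ∈ L²(P)` is the random variable with chaos decomposition `c`, i.e. `Z = Σ_n I_n(c_n)`. -/
def Represents (S : WienerSpace T) (c : Chaos T) (Z : Lp ℝ 2 S.P) : Prop :=
  HasSum (fun n => S.I n (c n)) Z

/-- The Wick product of two chaos series: `(c ⋄ d)_n = Σ_{j=0}^n c_j ⊗̂ d_{n-j}`. -/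
def wickKer (S : WienerSpace T) (c d : Chaos T) : Chaos T := fun n =>
  ∑ j ∈ (Finset.range (n + 1)).attach,
    kerCast (Nat.add_sub_cancel' (Nat.lt_succ_iff.mp (Finset.mem_range.mp j.2)))
      (S.stp (c j) (d (n - j)))

/-- The constant kernel `1` of order `0`. -/
def oneKer (T : ℝ) : Ker T 0 :=
  (memLp_const (1 : ℝ) : MemLp (fun _ : Fin 0 → ℝ => (1 : ℝ)) 2 (boxMeasure T 0)).toLp _

/-- The chaos series of the constant random variable `1`. -/
def unitChaos (T : ℝ) : Chaos T := fun n =>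
  if h : 0 = n then kerCast h (oneKer T) else 0

/-- Wick powers `c^{⋄n}` (with `c^{⋄0} = 1`). -/
def wickPow (S : WienerSpace T) (c : Chaos T) : ℕ → Chaos T
  | 0 => unitChaos T
  | n + 1 => S.wickKer (S.wickPow c n) c

/-- The `n`-fold Wick product `c 0 ⋄ ⋯ ⋄ c (n-1)`. -/
def wickFold (S : WienerSpace T) {n : ℕ} (c : Fin n → Chaos T) : Chaos T :=
  (List.ofFn c).foldr S.wickKer (unitChaos T)

/-- The stochastic exponential `ℰ(h) = exp{∫₀^T h dB − ½∫₀^T h² ds}`, where `∫₀^T h dB = I_1(h)`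
is the Wiener integral of `h` and `∫₀^T h² ds = ‖h‖²`. -/
def stochExp (S : WienerSpace T) (h : Ker T 1) : PathSpace T → ℝ := fun ω =>
  Real.exp ((S.I 1 h : PathSpace T → ℝ) ω - ‖h‖ ^ 2 / 2)

/-- The stochastic exponential with purely imaginary argument:
`ℰ(ih) = exp{i ∫₀^T h dB − ½∫₀^T (ih)² ds} = exp{i I_1(h) + ‖h‖²/2}`. -/
def stochExpI (S : WienerSpace T) (h : Ker T 1) : PathSpace T → ℂ := fun ω =>
  Complex.exp (Complex.I * ((S.I 1 h : PathSpace T → ℝ) ω : ℂ) + (‖h‖ : ℂ) ^ 2 / 2)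

/-- The Ornstein–Uhlenbeck semigroup:
`(P_t X)(ω) = ∫ X(e^{−t} ω + √(1 − e^{−2t}) ω̃) dP(ω̃)`. -/
def ou (S : WienerSpace T) (t : ℝ) (X : PathSpace T → ℝ) : PathSpace T → ℝ := fun ω =>
  ∫ ω' : PathSpace T,
    X (Real.exp (-t) • ω + Real.sqrt (1 - Real.exp (-2 * t)) • ω') ∂S.P

end WienerSpace

/-- Convergence in distribution of real random variables on a measure space towards a law `ν`,
tested against bounded continuous functions. -/
def TendstoInDistribution {α : Type*} [MeasurableSpace α] (P : Measure α)
    (Xn : ℕ → α → ℝ) (ν : Measure ℝ) : Prop :=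
  ∀ f : BoundedContinuousFunction ℝ ℝ,
    Tendsto (fun n => ∫ ω, f (Xn n ω) ∂P) atTop (𝓝 (∫ x, f x ∂ν))

/-- Positive definiteness of a complex-valued function on `L²([0,T])`. -/
def PosDefFn {T : ℝ} (φ : Ker T 1 → ℂ) : Prop :=
  ∀ (n : ℕ) (h : Fin n → Ker T 1) (c : Fin n → ℂ),
    0 ≤ (∑ i, ∑ j, c i * (starRingEnd ℂ) (c j) * φ (h i - h j)).re ∧
      (∑ i, ∑ j, c i * (starRingEnd ℂ) (c j) * φ (h i - h j)).im = 0

end WickPaper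

namespace WickPaper

/-- Permuting (relabelling) the variables preserves the cube measure. -/
lemma mp_relabel {α β : Type*} [Fintype α] [Fintype β] (μ : Measure ℝ) [SigmaFinite μ]
    (e : α ≃ β) :
    MeasurePreserving (fun (x : β → ℝ) (a : α) => x (e a))
      (Measure.pi fun _ : β => μ) (Measure.pi fun _ : α => μ) := by
  have h := (measurePreserving_piCongrLeft (fun _ : β => μ) e).symm
  exact h

lemma mp_split (T : ℝ) {j m : ℕ} (σ : Equiv.Perm (Fin (j + m))) :
    MeasurePreserving
      (fun x : Fin (j + m) → ℝ =>
        ((fun i => x (σ (Fin.castAdd m i))), (fun i => x (σ (Fin.natAdd j i)))))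
      (boxMeasure T (j + m)) ((boxMeasure T j).prod (boxMeasure T m)) := by
  unfold boxMeasure
  have h1 := mp_relabel ((volume : Measure ℝ).restrict (Set.Icc 0 T))
    (finSumFinEquiv.trans σ : Fin j ⊕ Fin m ≃ Fin (j + m))
  have h2 := measurePreserving_sumPiEquivProdPi
    (fun _ : Fin j ⊕ Fin m => (volume : Measure ℝ).restrict (Set.Icc 0 T))
  exact h2.comp h1

lemma eLpNorm_prod_two {α β : Type*} [MeasurableSpace α] [MeasurableSpace β]
    (μ : Measure α) (ν : Measure β) [SigmaFinite μ] [SigmaFinite ν] (f : α → ℝ) (g : β → ℝ)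
    (hf : AEStronglyMeasurable f μ) (hg : AEStronglyMeasurable g ν) :
    eLpNorm (fun z : α × β => f z.1 * g z.2) 2 (μ.prod ν) = eLpNorm f 2 μ * eLpNorm g 2 ν := by
  simp only [eLpNorm_eq_lintegral_rpow_enorm_toReal (two_ne_zero) (ENNReal.ofNat_ne_top),
    enorm_mul]
  rw [← ENNReal.mul_rpow_of_nonneg _ _ (by simp)]
  congr 1
  simp only [ENNReal.toReal_ofNat]
  rw [← lintegral_prod_mul (hf.enorm.pow_const _) (hg.enorm.pow_const _)]
  refine lintegral_congr fun z => ?_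
  rw [ENNReal.mul_rpow_of_nonneg _ _ (by norm_num)]

lemma split_norm_aux {α β γ : Type*} [MeasurableSpace α] [MeasurableSpace β]
    [MeasurableSpace γ] (μ : Measure α) (ν : Measure β) (ρ : Measure γ)
    [SigmaFinite μ] [SigmaFinite ν] (φ : γ → α × β)
    (hφ : MeasurePreserving φ ρ (μ.prod ν)) (h : α → ℝ) (g : β → ℝ)
    (hh : AEStronglyMeasurable h μ) (hg : AEStronglyMeasurable g ν) :
    AEStronglyMeasurable (fun x => h (φ x).1 * g (φ x).2) ρ ∧
    eLpNorm (fun x => h (φ x).1 * g (φ x).2) 2 ρ = eLpNorm h 2 μ * eLpNorm g 2 ν := by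
  have h1 : AEStronglyMeasurable (fun z : α × β => h z.1) (μ.prod ν) := hh.comp_fst
  have h2 : AEStronglyMeasurable (fun z : α × β => g z.2) (μ.prod ν) := hg.comp_snd
  have hprod : AEStronglyMeasurable (fun z : α × β => h z.1 * g z.2) (μ.prod ν) :=
    AEStronglyMeasurable.mul h1 h2
  have h3 := hprod.comp_measurePreserving hφ
  have h4 := eLpNorm_comp_measurePreserving (p := 2) hprod hφ
  have h5 := eLpNorm_prod_two μ ν h g hh hg
  exact ⟨h3, h4.trans h5⟩

lemma split_norm (T : ℝ) {j m : ℕ} (σ : Equiv.Perm (Fin (j + m)))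
    (h : (Fin j → ℝ) → ℝ) (g : (Fin m → ℝ) → ℝ)
    (hh : AEStronglyMeasurable h (boxMeasure T j))
    (hg : AEStronglyMeasurable g (boxMeasure T m)) :
    AEStronglyMeasurable (fun x : Fin (j + m) → ℝ =>
      h (fun i => x (σ (Fin.castAdd m i))) * g (fun i => x (σ (Fin.natAdd j i))))
      (boxMeasure T (j + m)) ∧
    eLpNorm (fun x : Fin (j + m) → ℝ =>
      h (fun i => x (σ (Fin.castAdd m i))) * g (fun i => x (σ (Fin.natAdd j i)))) 2
      (boxMeasure T (j + m)) = eLpNorm h 2 (boxMeasure T j) * eLpNorm g 2 (boxMeasure T m) :=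
  split_norm_aux _ _ _ _ (mp_split T σ) h g hh hg

lemma stp_nnnorm_le {T : ℝ} (S : WienerSpace T) {j m : ℕ} (h : Ker T j) (g : Ker T m) :
    ‖S.stp h g‖₊ ≤ ‖h‖₊ * ‖g‖₊ := by
  rw [← ENNReal.coe_le_coe, ENNReal.coe_mul]
  change ‖S.stp h g‖ₑ ≤ ‖h‖ₑ * ‖g‖ₑ
  rw [Lp.enorm_def, Lp.enorm_def, Lp.enorm_def, eLpNorm_congr_ae (S.stp_spec h g)]
  set F : Equiv.Perm (Fin (j + m)) → (Fin (j + m) → ℝ) → ℝ := fun σ x =>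
    h (fun i => x (σ (Fin.castAdd m i))) * g (fun i => x (σ (Fin.natAdd j i))) with hF
  have hmeas : ∀ σ, AEStronglyMeasurable (F σ) (boxMeasure T (j + m)) := fun σ =>
    (split_norm T σ _ _ (Lp.aestronglyMeasurable h) (Lp.aestronglyMeasurable g)).1
  have hnorm : ∀ σ, eLpNorm (F σ) 2 (boxMeasure T (j + m))
      = eLpNorm h 2 (boxMeasure T j) * eLpNorm g 2 (boxMeasure T m) := fun σ =>
    (split_norm T σ _ _ (Lp.aestronglyMeasurable h) (Lp.aestronglyMeasurable g)).2
  have heq : (fun x => ((Nat.factorial (j + m) : ℝ))⁻¹ *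
        ∑ σ : Equiv.Perm (Fin (j + m)),
          h (fun i => x (σ (Fin.castAdd m i))) * g (fun i => x (σ (Fin.natAdd j i))))
      = ((Nat.factorial (j + m) : ℝ))⁻¹ • ∑ σ, F σ := by
    ext x; simp [hF]
  have hfac : ((Nat.factorial (j + m) : ℝ)) ≠ 0 := by positivity
  rw [heq, eLpNorm_const_smul]
  grw [eLpNorm_sum_le (fun σ _ => hmeas σ) (by norm_num)]
  simp only [hnorm, Finset.sum_const, Finset.card_univ, Fintype.card_perm, Fintype.card_fin,
    nsmul_eq_mul]
  rw [enorm_inv hfac, Real.enorm_natCast, ← mul_assoc, ENNReal.inv_mul_cancel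
    (by exact_mod_cast Nat.factorial_ne_zero _) (by simp), one_mul]

lemma stp_symm {T : ℝ} (S : WienerSpace T) {j m : ℕ} (h : Ker T j) (g : Ker T m) :
    IsSymmKer (S.stp h g) := by
  intro τ
  have hmp : MeasurePreserving (fun (x : Fin (j + m) → ℝ) => x ∘ τ)
      (boxMeasure T (j + m)) (boxMeasure T (j + m)) := mp_relabel _ τ
  have h1 := hmp.quasiMeasurePreserving.ae_eq_comp (S.stp_spec h g)
  refine (h1.trans ?_).trans (S.stp_spec h g).symm
  refine Eventually.of_forall fun x => ?_
  simp only [Function.comp_def]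
  congr 1
  exact Equiv.sum_comp (Equiv.mulLeft τ) (fun σ : Equiv.Perm (Fin (j + m)) =>
    h (fun i => x (σ (Fin.castAdd m i))) * g (fun i => x (σ (Fin.natAdd j i))))

lemma symm_zero {T : ℝ} {n : ℕ} : IsSymmKer (0 : Ker T n) := by
  intro τ
  have hmp : MeasurePreserving (fun (x : Fin n → ℝ) => x ∘ τ)
      (boxMeasure T n) (boxMeasure T n) := mp_relabel _ τ
  have h0 := Lp.coeFn_zero ℝ 2 (boxMeasure T n)
  exact (hmp.quasiMeasurePreserving.ae_eq_comp h0).trans h0.symm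

lemma symm_add {T : ℝ} {n : ℕ} {f g : Ker T n} (hf : IsSymmKer f) (hg : IsSymmKer g) :
    IsSymmKer (f + g) := by
  intro τ
  have hmp : MeasurePreserving (fun (x : Fin n → ℝ) => x ∘ τ)
      (boxMeasure T n) (boxMeasure T n) := mp_relabel _ τ
  have h0 := Lp.coeFn_add f g
  refine (hmp.quasiMeasurePreserving.ae_eq_comp h0).trans (EventuallyEq.trans ?_ h0.symm)
  exact (hf τ).add (hg τ)

lemma symm_smul {T : ℝ} {n : ℕ} (a : ℝ) {f : Ker T n} (hf : IsSymmKer f) :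
    IsSymmKer (a • f) := by
  intro τ
  have hmp : MeasurePreserving (fun (x : Fin n → ℝ) => x ∘ τ)
      (boxMeasure T n) (boxMeasure T n) := mp_relabel _ τ
  have h0 := Lp.coeFn_smul a f
  refine (hmp.quasiMeasurePreserving.ae_eq_comp h0).trans (EventuallyEq.trans ?_ h0.symm)
  exact (hf τ).const_smul a

lemma symm_sum {T : ℝ} {n : ℕ} {ι : Type*} (s : Finset ι) (f : ι → Ker T n)
    (hf : ∀ i, IsSymmKer (f i)) : IsSymmKer (∑ i ∈ s, f i) := by
  classical
  induction s using Finset.induction_on with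
  | empty => simpa using symm_zero
  | insert i s hi ih => rw [Finset.sum_insert hi]; exact symm_add (hf i) ih

lemma symm_cast {T : ℝ} {j n : ℕ} (e : j = n) {f : Ker T j} (hf : IsSymmKer f) :
    IsSymmKer (kerCast e f) := by
  subst e; exact hf

lemma nnnorm_cast {T : ℝ} {j n : ℕ} (e : j = n) (f : Ker T j) :
    ‖kerCast e f‖₊ = ‖f‖₊ := by
  subst e; rfl

lemma wick_symm {T : ℝ} (S : WienerSpace T) (c d : Chaos T) (n : ℕ) :
    IsSymmKer (S.wickKer c d n) :=
  symm_sum _ _ fun _ => symm_cast _ (stp_symm S _ _)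

lemma wick_nnnorm_le {T : ℝ} (S : WienerSpace T) (c d : Chaos T) (n : ℕ) :
    ‖S.wickKer c d n‖₊ ≤ ∑ j ∈ Finset.range (n + 1), ‖c j‖₊ * ‖d (n - j)‖₊ := by
  rw [← Finset.sum_attach]
  refine (nnnorm_sum_le _ _).trans (Finset.sum_le_sum fun j _ => ?_)
  rw [nnnorm_cast]
  exact stp_nnnorm_le S _ _

lemma nnnorm_oneKer (T : ℝ) : ‖WienerSpace.oneKer T‖₊ ≤ 1 := by
  rw [← ENNReal.coe_le_coe]
  change ‖WienerSpace.oneKer T‖ₑ ≤ _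
  unfold WienerSpace.oneKer
  rw [Lp.enorm_toLp]
  have : boxMeasure T 0 Set.univ = 1 := by simp [boxMeasure]
  rw [eLpNorm_const' _ (by simp) (by simp), this]
  simp

lemma wickPow_one_le {T : ℝ} (S : WienerSpace T) (c : Chaos T) (n : ℕ) :
    ‖S.wickPow c 1 n‖₊ ≤ ‖c n‖₊ := by
  refine (wick_nnnorm_le S _ _ n).trans ?_
  rw [Finset.sum_eq_single 0]
  · refine mul_le_of_le_one_left (by positivity) ?_
    change ‖WienerSpace.unitChaos T 0‖₊ ≤ 1
    simp only [WienerSpace.unitChaos, dite_true]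
    rw [nnnorm_cast]
    exact nnnorm_oneKer T
  · intro j _ hj
    have : S.wickPow c 0 j = 0 := by
      change WienerSpace.unitChaos T j = 0
      simp [WienerSpace.unitChaos, hj.symm]
    simp [this]
  · simp

/-- The weighted Cauchy–Schwarz step. -/
lemma cs_step (w a : ℕ → ℝ≥0) (m : ℕ) (hm : 1 ≤ m) (k : ℕ) :
    (k.factorial : ℝ≥0) * (((m + 1 : ℕ) : ℝ≥0) ^ k)⁻¹ *
      (∑ j ∈ Finset.range (k + 1), w j * a (k - j)) ^ 2 ≤
    ∑ j ∈ Finset.range (k + 1),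
      ((j.factorial : ℝ≥0) * ((m : ℝ≥0) ^ j)⁻¹ * w j ^ 2) *
        (((k - j).factorial : ℝ≥0) * a (k - j) ^ 2) := by
  have hm0 : (m : ℝ≥0) ≠ 0 := by exact_mod_cast (by omega : m ≠ 0)
  have hC : ∀ j ∈ Finset.range (k + 1), ((k.choose j : ℕ) : ℝ≥0) ≠ 0 := fun j hj => by
    exact_mod_cast (Nat.choose_pos (Nat.lt_succ_iff.mp (Finset.mem_range.mp hj))).ne'
  have hcs := Finset.sum_sq_le_sum_mul_sum_of_sq_le_mul (Finset.range (k + 1))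
    (r := fun j => w j * a (k - j))
    (f := fun j => (k.choose j : ℝ≥0) * (m : ℝ≥0) ^ j)
    (g := fun j => (w j * a (k - j)) ^ 2 / ((k.choose j : ℝ≥0) * (m : ℝ≥0) ^ j))
    (fun _ _ => zero_le) (fun _ _ => zero_le)
    (fun j hj => le_of_eq (by
      have := hC j hj
      field_simp))
  have hbin : ∑ j ∈ Finset.range (k + 1), (k.choose j : ℝ≥0) * (m : ℝ≥0) ^ j
      = ((m + 1 : ℕ) : ℝ≥0) ^ k := by
    push_cast
    rw [add_pow]
    refine Finset.sum_congr rfl fun j _ => ?_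
    simp [mul_comm]
  rw [hbin] at hcs
  grw [hcs]
  have hm1 : (((m + 1 : ℕ) : ℝ≥0) ^ k) ≠ 0 := by positivity
  rw [mul_assoc, ← mul_assoc (_⁻¹), inv_mul_cancel₀ hm1, one_mul, Finset.mul_sum]
  refine le_of_eq (Finset.sum_congr rfl fun j hj => ?_)
  have h1 := hC j hj
  have h2 : (k.factorial : ℝ≥0) = k.choose j * j.factorial * (k - j).factorial := by
    exact_mod_cast (Nat.choose_mul_factorial_mul_factorial
      (Nat.lt_succ_iff.mp (Finset.mem_range.mp hj))).symm
  rw [h2]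
  field_simp

lemma tsum_cauchy (f g : ℕ → ℝ≥0∞) :
    ∑' k, ∑ j ∈ Finset.range (k + 1), f j * g (k - j) = (∑' k, f k) * ∑' k, g k := by
  simp_rw [← Finset.Nat.sum_antidiagonal_eq_sum_range_succ fun k l => f k * g l]
  rw [← ENNReal.tsum_mul_right]
  simp_rw [← ENNReal.tsum_mul_left]
  rw [← ENNReal.tsum_prod (f := fun a b => f a * g b),
    ← Finset.HasAntidiagonal.sigmaAntidiagonalEquivProd.tsum_eq (_ : ℕ × ℕ → ℝ≥0∞),
    ENNReal.tsum_sigma']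
  refine tsum_congr fun n => ?_
  rw [tsum_fintype, ← Finset.sum_coe_sort]
  rfl

lemma main_bound {T : ℝ} (S : WienerSpace T) (c : Chaos T) (n : ℕ) (hn : 1 ≤ n) :
    ∑' k : ℕ, (((k.factorial : ℝ≥0) * ((n : ℝ≥0) ^ k)⁻¹ * ‖S.wickPow c n k‖₊ ^ 2 : ℝ≥0) : ℝ≥0∞)
      ≤ chaosNorm2 c ^ n := by
  induction n, hn using Nat.le_induction with
  | base =>
    rw [pow_one, chaosNorm2]
    refine ENNReal.tsum_le_tsum fun k => ?_
    have := wickPow_one_le S c k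
    have h2 : (k.factorial : ℝ≥0) * (((1 : ℕ) : ℝ≥0) ^ k)⁻¹ * ‖S.wickPow c 1 k‖₊ ^ 2
        ≤ (k.factorial : ℝ≥0) * ‖c k‖₊ ^ 2 := by
      simp only [Nat.cast_one, one_pow, inv_one, mul_one]
      gcongr
    exact_mod_cast h2
  | succ m hm ih =>
    rw [pow_succ]
    refine le_trans ?_ (mul_le_mul_left ih _)
    rw [chaosNorm2, ← tsum_cauchy]
    refine ENNReal.tsum_le_tsum fun k => ?_
    have h1 := cs_step (fun j => ‖S.wickPow c m j‖₊) (fun j => ‖c j‖₊) m hm k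
    have h2 : ‖S.wickPow c (m + 1) k‖₊ ≤ _ := wick_nnnorm_le S (S.wickPow c m) c k
    have h3 := le_trans (mul_le_mul_right (pow_le_pow_left₀ zero_le h2 2)
      ((k.factorial : ℝ≥0) * (((m + 1 : ℕ) : ℝ≥0) ^ k)⁻¹)) h1
    refine (ENNReal.coe_le_coe.mpr h3).trans (le_of_eq ?_)
    push_cast
    rfl

lemma gam_bound {T : ℝ} (S : WienerSpace T) (c : Chaos T) (n : ℕ) (hn : 1 ≤ n) :
    chaosNorm2 (Gam ((n : ℝ))⁻¹ (S.wickPow c n)) ≤ chaosNorm2 c ^ n := by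
  refine le_trans ?_ (main_bound S c n hn)
  refine ENNReal.tsum_le_tsum fun k => ?_
  have hn1 : (1 : ℝ≥0) ≤ n := by exact_mod_cast hn
  have h : (k.factorial : ℝ≥0) * ‖Gam ((n : ℝ))⁻¹ (S.wickPow c n) k‖₊ ^ 2 ≤
      (k.factorial : ℝ≥0) * ((n : ℝ≥0) ^ k)⁻¹ * ‖S.wickPow c n k‖₊ ^ 2 := by
    simp only [Gam]
    rw [nnnorm_smul, mul_pow, ← mul_assoc]
    gcongr
    have : ‖((n : ℝ)⁻¹) ^ k‖₊ = ((n : ℝ≥0) ^ k)⁻¹ := by simp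
    rw [this]
    refine pow_le_of_le_one zero_le ?_ (by norm_num)
    exact inv_le_one_of_one_le₀ (one_le_pow₀ hn1)
  exact_mod_cast h

lemma summable_of_orth {E : Type*} [NormedAddCommGroup E] [InnerProductSpace ℝ E]
    [CompleteSpace E] (v : ℕ → E) (ho : ∀ i j, i ≠ j → inner ℝ (v i) (v j) = (0 : ℝ))
    (hs : Summable fun i => ‖v i‖ ^ 2) : Summable v := by
  have hV : OrthogonalFamily ℝ (fun i => (Submodule.span ℝ {v i} : Submodule ℝ E))
      (fun i => (Submodule.span ℝ {v i}).subtypeₗᵢ) := by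
    intro i j hij x y
    obtain ⟨a, ha⟩ := Submodule.mem_span_singleton.mp x.2
    obtain ⟨b, hb⟩ := Submodule.mem_span_singleton.mp y.2
    change inner ℝ (x : E) (y : E) = 0
    rw [← ha, ← hb, inner_smul_left, inner_smul_right, ho i j hij]
    simp
  exact (hV.summable_iff_norm_sq_summable
    (fun i => ⟨v i, Submodule.mem_span_singleton_self _⟩)).mpr hs

/-- For `X ∈ L²(P)` and `n ≥ 1`, `Γ(1/n) X^{⋄n} ∈ L²(P)` and
`‖Γ(1/n) X^{⋄n}‖ ≤ ‖X‖^n`. -/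
theorem gamma_wick_power_memL2 {T : ℝ} (S : WienerSpace T) (X : Lp ℝ 2 S.P)
    (n : ℕ) (hn : 1 ≤ n) :
    (∃ Z : Lp ℝ 2 S.P, S.Represents (Gam ((n : ℝ))⁻¹ (S.wickPow (S.kernels X) n)) Z) ∧
    chaosNorm2 (Gam ((n : ℝ))⁻¹ (S.wickPow (S.kernels X) n)) ^ (1 / 2 : ℝ) ≤
      (‖X‖₊ : ℝ≥0∞) ^ n := by
  have hb := gam_bound S (S.kernels X) n hn
  rw [← S.norm_eq X] at hb
  set d := Gam ((n : ℝ))⁻¹ (S.wickPow (S.kernels X) n) with hd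
  refine ⟨?_, ?_⟩
  · have hsymm : ∀ k, IsSymmKer (d k) := by
      intro k
      obtain ⟨m, rfl⟩ : ∃ m, n = m + 1 := ⟨n - 1, by omega⟩
      exact symm_smul _ (wick_symm S (S.wickPow (S.kernels X) m) (S.kernels X) k)
    have hfin : chaosNorm2 d ≠ ⊤ := ne_top_of_le_ne_top (by finiteness) hb
    have hsum : Summable fun k => ((k.factorial : ℝ≥0) * ‖d k‖₊ ^ 2) := by
      rw [← ENNReal.tsum_coe_ne_top_iff_summable]
      simpa [chaosNorm2] using hfin
    obtain ⟨Z, hZ⟩ := summable_of_orth (fun k => S.I k (d k))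
      (fun i j hij => S.I_orth hij _ _) (by
        have h2 := NNReal.summable_coe.mpr hsum
        refine h2.congr fun k => ?_
        rw [S.I_norm k _ (hsymm k), mul_pow, Real.sq_sqrt (by positivity)]
        simp)
    exact ⟨Z, hZ⟩
  · grw [hb]
    rw [← pow_mul, mul_comm 2 n, pow_mul, ← ENNReal.rpow_natCast, ← ENNReal.rpow_mul]
    norm_num

end WickPaper
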